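/- arXiv:1809.03310 — 2 statements merged into one kernel-verified Lean document; each statement's English description precedes it below -/
import Mathlib

section
/- Let p ∈ (2, 7/3) and set m* = 9(p−2)/(7−3p). Then ψ(m*) > m* if and only if p > 23/11. -/
/-- ψ(m) = (1/9)(2(p+3)(p−1)m² + 3(4p²−5p−8)m + 9(2p−5)(p−2)) -/
noncomputable def psi (p m : ℝ) : ℝ :=
  (1/9) * (2*(p+3)*(p-1)*m^2 + 3*(4*p^2 - 5*p - 8)*m + 9*(2*p-5)*(p-2))

theorem stmt_0 (p : ℝ) (hp2 : 2 < p) (hp73 : p < 7/3) :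
    psi p (9*(p-2)/(7-3*p)) > 9*(p-2)/(7-3*p) ↔ p > 23/11 := by
  have hD : 0 < 7 - 3*p := by linarith
  have hD' : 7 - 3*p ≠ 0 := hD.ne'
  have key : psi p (9*(p-2)/(7-3*p)) - 9*(p-2)/(7-3*p)
      = (16*(p-2)/(7-3*p)^2) * (11*p-23) := by
    unfold psi
    generalize hd : 7 - 3*p = d at hD'
    obtain rfl : p = (7 - d)/3 := by linarith
    field_simp
    ring
  have hc : 0 < 16*(p-2)/(7-3*p)^2 := by
    have : 0 < p - 2 := by linarith
    positivity
  rw [gt_iff_lt, ← sub_pos, key, mul_pos_iff_of_pos_left hc]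
  constructor <;> intro h <;> linarith
end

section
/- Let p ≥ 2, q ≥ 2, m* ≥ 1 be real numbers and let m satisfy (2q(p−1)−p)/(2q(p−1))·m* + (p−2)/(p−1) < m ≤ (2q(p−1)−p)/3·m* + (2q−1)(p−2). Then the number θ₁ = 3(m+p−2)·(2q(m(p−1) − p(m*+1) + m* + 2) + p·m*) / (2q·(m(p−1)−p+2)·(3(m+p−2)+(p−3)m*)) satisfies 0 < θ₁ < 1. -/
theorem stmt_6 (p q m₀ m : ℝ) (hp : 2 ≤ p) (hq : 2 ≤ q) (hm₀ : 1 ≤ m₀)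
    (hml : (2*q*(p-1) - p)/(2*q*(p-1)) * m₀ + (p-2)/(p-1) < m)
    (hmr : m ≤ (2*q*(p-1) - p)/3 * m₀ + (2*q-1)*(p-2)) :
    0 < 3*(m+p-2) * (2*q*(m*(p-1) - p*(m₀+1) + m₀ + 2) + p*m₀)
        / (2*q * (m*(p-1) - p + 2) * (3*(m+p-2) + (p-3)*m₀))
    ∧ 3*(m+p-2) * (2*q*(m*(p-1) - p*(m₀+1) + m₀ + 2) + p*m₀)
        / (2*q * (m*(p-1) - p + 2) * (3*(m+p-2) + (p-3)*m₀)) < 1 := by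
  have hp1 : 0 < p - 1 := by linarith
  have hq0 : 0 < q := by linarith
  have hm0 : 0 < m₀ := by linarith
  have hqp : 0 < 2*q*(p-1) := by positivity
  have e : (2*q*(p-1) - p)/(2*q*(p-1)) * m₀ + (p-2)/(p-1)
      = ((2*q*(p-1) - p) * m₀ + 2*q*(p-2)) / (2*q*(p-1)) := by
    field_simp
  rw [e, div_lt_iff₀ hqp] at hml
  have hK : q*(p-1) ≤ 2*q*(p-1) - p := by nlinarith
  have hK0 : 0 < 2*q*(p-1) - p := by
    have : 0 < q*(p-1) := by positivity
    linarith
  have hN : 0 < 2*q*(m*(p-1) - p*(m₀+1) + m₀ + 2) + p*m₀ := by linarith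
  have hKm : 0 < (2*q*(p-1) - p) * m₀ := by positivity
  have hD : 0 < m*(p-1) - p + 2 := by
    have : 0 < (2*q) * (m*(p-1) - p + 2) := by linarith
    exact pos_of_mul_pos_right this (by positivity)
  have hm : m₀ / 2 < m := by
    have h1 : q*(p-1)*m₀ ≤ (2*q*(p-1) - p) * m₀ := by gcongr
    have h2 : 0 ≤ 2*q*(p-2) := mul_nonneg (by positivity) (by linarith)
    have h3 : 0 < (2*q*(p-1)) * (m - m₀/2) := by linarith
    have := pos_of_mul_pos_right h3 hqp.le
    linarith
  have hS : 0 < m + p - 2 := by linarith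
  have hE : 0 < 3*(m+p-2) + (p-3)*m₀ := by nlinarith
  have hden : 0 < 2*q * (m*(p-1) - p + 2) * (3*(m+p-2) + (p-3)*m₀) := by positivity
  refine ⟨by positivity, ?_⟩
  rw [div_lt_one hden]
  have key : 0 < 2*q*(m*(p-1) - p + 2)*(p-3) + 3*(m+p-2)*(2*q*(p-1) - p) := by
    rcases le_total 3 p with h | h
    · have h1 : 0 ≤ 2*q*(m*(p-1) - p + 2)*(p-3) := mul_nonneg (by positivity) (by linarith)
      have h2 : 0 < 3*(m+p-2)*(2*q*(p-1) - p) := by positivity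
      linarith
    · have h1 : 0 ≤ 2*q*((3-p)*(p*(p-2))) :=
        mul_nonneg (by positivity) (mul_nonneg (by linarith) (mul_nonneg (by linarith) (by linarith)))
      have h3 : 0 < 2*q*(p-1) - 3 := by nlinarith
      have h2 : 0 < (m+p-2)*p*(2*q*(p-1) - 3) := mul_pos (mul_pos hS (by linarith)) h3
      linarith
  have := mul_pos hm0 key
  linarith
end
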